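/- Let F = c₀M₀ + Σ_{i=1}^{d} cᵢMᵢ ∈ ℂ[x₁,…,xₙ], where M₀ = x₁^{k₁}x₂^{k₂}⋯xₙ^{kₙ} is a monomial with k₁ ≥ 1 and k₁ ≥ k_j for all 2 ≤ j ≤ n, the coefficients satisfy cᵢ ∈ ℂ for 0 ≤ i ≤ d with c₀ ≠ 0, and each Mᵢ for 1 ≤ i ≤ d is a monomial in x₁,…,xₙ divisible by x₁^{k₁+1}. Then E(Fᵐ) ≠ 0 for infinitely many integers m ≥ 1, where E denotes the Gaussian expectation with respect to γₙ. -/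

import Mathlib

open MeasureTheory ProbabilityTheory

/-- The Gaussian expectation of a complex polynomial in the variables indexed by `σ`,
with respect to the standard Gaussian measure (product of `N(0,1)`'s). -/
noncomputable def gaussExp {σ : Type*} [Fintype σ] (P : MvPolynomial σ ℂ) : ℂ :=
  ∫ x : σ → ℝ, MvPolynomial.eval (fun i => (x i : ℂ)) P
    ∂(Measure.pi fun _ : σ => gaussianReal 0 1)

/-- The moments of the standard Gaussian distribution on `ℝ`. -/
def gaussMoment : ℕ → ℕ
  | 0 => 1
  | 1 => 0
  | j + 2 => (j + 1) * gaussMoment j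

lemma integrable_pow_gaussianReal (j : ℕ) :
    Integrable (fun x : ℝ => x ^ j) (gaussianReal 0 1) := by
  rw [← integrable_norm_iff (by fun_prop)]
  simpa using (memLp_id_gaussianReal (μ := 0) (v := 1) (j : NNReal)).integrable_norm_pow'

lemma integrable_gaussianPDFReal_mul_pow (j : ℕ) :
    Integrable (fun x : ℝ => gaussianPDFReal 0 1 x * x ^ j) := by
  have h := integrable_pow_gaussianReal j
  rw [gaussianReal_of_var_ne_zero 0 one_ne_zero, integrable_withDensity_iff_integrable_smul'
    (measurable_gaussianPDF 0 1) (ae_of_all _ fun _ => gaussianPDF_lt_top)] at h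
  simpa using h

lemma hasDerivAt_gaussianPDFReal (x : ℝ) :
    HasDerivAt (gaussianPDFReal 0 1) (-x * gaussianPDFReal 0 1 x) x := by
  have h : HasDerivAt (fun y : ℝ => -(y - 0) ^ 2 / (2 * ((1 : NNReal) : ℝ))) (-x) x := by
    have := (((hasDerivAt_id x).sub_const 0).pow 2).neg.div_const (2 * ((1 : NNReal) : ℝ))
    convert! this using 1
    simp
    ring
  have h2 := h.exp.const_mul (√(2 * Real.pi * ((1 : NNReal) : ℝ)))⁻¹
  convert! h2 using 1
  rw [gaussianPDFReal]
  ring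

lemma integral_pow_gaussianReal_succ (j : ℕ) :
    ∫ x : ℝ, x ^ (j + 1) ∂gaussianReal 0 1 = j * ∫ x : ℝ, x ^ (j - 1) ∂gaussianReal 0 1 := by
  simp_rw [integral_gaussianReal_eq_integral_smul (one_ne_zero : (1 : NNReal) ≠ 0), smul_eq_mul]
  have h := integral_eq_zero_of_hasDerivAt_of_integrable
    (f := fun x : ℝ => gaussianPDFReal 0 1 x * x ^ j)
    (f' := fun x => j * (gaussianPDFReal 0 1 x * x ^ (j - 1))
      - gaussianPDFReal 0 1 x * x ^ (j + 1))
    (fun x => by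
      convert! (hasDerivAt_gaussianPDFReal x).mul (hasDerivAt_pow j x) using 1
      ring)
    (((integrable_gaussianPDFReal_mul_pow _).const_mul _).sub
      (integrable_gaussianPDFReal_mul_pow _))
    (integrable_gaussianPDFReal_mul_pow j)
  rw [integral_sub ((integrable_gaussianPDFReal_mul_pow _).const_mul _)
      (integrable_gaussianPDFReal_mul_pow _), integral_const_mul] at h
  linarith

lemma integral_pow_gaussianReal (j : ℕ) :
    ∫ x : ℝ, x ^ j ∂gaussianReal 0 1 = gaussMoment j := by
  induction j using gaussMoment.induct with
  | case1 => simp [gaussMoment]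
  | case2 => simp [gaussMoment]
  | case3 j ih =>
    rw [integral_pow_gaussianReal_succ (j + 1), Nat.add_sub_cancel, ih, gaussMoment]
    push_cast
    rfl

lemma gaussMoment_of_odd {j : ℕ} (hj : Odd j) : gaussMoment j = 0 := by
  induction j using gaussMoment.induct with
  | case1 => simp at hj
  | case2 => rfl
  | case3 j ih =>
    rw [gaussMoment, ih (by grind), mul_zero]

lemma dvd_gaussMoment {p j : ℕ} (hp : Odd p) (hj : p ≤ j) : p ∣ gaussMoment j := by
  induction j using gaussMoment.induct with
  | case1 => grind
  | case2 => simp [gaussMoment]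
  | case3 j ih =>
    rcases Nat.lt_trichotomy p (j + 1) with h | h | h
    · exact (ih (by omega)).mul_left _
    · exact h ▸ dvd_mul_right _ _
    · rw [gaussMoment_of_odd (by grind)]
      exact dvd_zero _

lemma not_dvd_gaussMoment {p j : ℕ} (hp : p.Prime) (he : Even j) (hj : j < p) :
    ¬ p ∣ gaussMoment j := by
  induction j using gaussMoment.induct with
  | case1 => simp [gaussMoment, hp.ne_one]
  | case2 => simp at he
  | case3 j ih =>
    rw [gaussMoment, hp.dvd_mul, not_or]
    exact ⟨Nat.not_dvd_of_pos_of_lt (by omega) (by omega), ih (by grind) (by omega)⟩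

section Expectation

variable {σ : Type*} [Fintype σ]

lemma integrable_eval_gaussian (P : MvPolynomial σ ℂ) :
    Integrable (fun x : σ → ℝ => MvPolynomial.eval (fun i => (x i : ℂ)) P)
      (Measure.pi fun _ : σ => gaussianReal 0 1) := by
  induction P using MvPolynomial.monomial_add_induction_on with
  | C a => simp
  | monomial_add s a P _ _ hP =>
    simp only [map_add]
    refine Integrable.add ?_ hP
    simp only [MvPolynomial.eval_monomial, Finsupp.prod_fintype _ _ (fun _ => pow_zero _)]
    refine Integrable.const_mul (Integrable.fintype_prod (f := fun i (y : ℝ) => (y : ℂ) ^ s i)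
      fun i => ?_) a
    simpa using (integrable_pow_gaussianReal (s i)).ofReal (𝕜 := ℂ)

lemma gaussExp_add (P Q : MvPolynomial σ ℂ) : gaussExp (P + Q) = gaussExp P + gaussExp Q := by
  simp only [gaussExp, map_add]
  exact integral_add (integrable_eval_gaussian P) (integrable_eval_gaussian Q)

lemma gaussExp_monomial (s : σ →₀ ℕ) (a : ℂ) :
    gaussExp (MvPolynomial.monomial s a) = a * ∏ i, (gaussMoment (s i) : ℂ) := by
  simp only [gaussExp, MvPolynomial.eval_monomial, Finsupp.prod_fintype _ _ (fun _ => pow_zero _)]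
  rw [integral_const_mul, integral_fintype_prod_eq_prod (f := fun i (y : ℝ) => (y : ℂ) ^ s i)]
  congr 1
  refine Finset.prod_congr rfl fun i _ => ?_
  simp_rw [← Complex.ofReal_pow]
  rw [integral_complex_ofReal, integral_pow_gaussianReal, Complex.ofReal_natCast]

/-- For odd `p`, the expectation of a polynomial divisible by `xᵢ ^ p` is a multiple of `p`
in the ring of coefficients. -/
lemma exists_gaussExp_eq_mul_of_X_pow_dvd {A : Type*} [CommRing A] (φ : A →+* ℂ) {p : ℕ}
    (hp : Odd p) (i : σ) {P : MvPolynomial σ A} (hP : MvPolynomial.X i ^ p ∣ P) :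
    ∃ a : A, gaussExp (MvPolynomial.map φ P) = p * φ a := by
  classical
  obtain ⟨Q, rfl⟩ := hP
  induction Q using MvPolynomial.induction_on' with
  | add Q R hQ hR =>
    obtain ⟨a, ha⟩ := hQ
    obtain ⟨b, hb⟩ := hR
    exact ⟨a + b, by rw [mul_add, map_add, gaussExp_add, ha, hb, map_add, mul_add]⟩
  | monomial s a =>
    obtain ⟨q, hq⟩ : p ∣ ∏ j, gaussMoment ((Finsupp.single i p + s) j) :=
      (dvd_gaussMoment hp (by simp)).trans (Finset.dvd_prod_of_mem _ (Finset.mem_univ i))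
    refine ⟨q * a, ?_⟩
    rw [MvPolynomial.X_pow_eq_monomial, MvPolynomial.monomial_mul, MvPolynomial.map_monomial,
      gaussExp_monomial, ← Nat.cast_prod, hq]
    push_cast
    simp only [one_mul, map_mul, map_natCast]
    ring

end Expectation

/-- Only finitely many primes become invertible in a finitely generated subring of a ring
that maps to a number field. -/
lemma exists_forall_prime_mul_ne_one_of_ringHom {B L : Type*} [CommRing B] [Field L]
    [Algebra ℚ L] [Algebra.IsAlgebraic ℚ L] (f : B →+* L) {T : Set B} (hT : T.Finite) :
    ∃ N : ℕ, ∀ p : ℕ, p.Prime → N < p → ∀ b ∈ Algebra.adjoin ℤ T, (p : B) * b ≠ 1 := by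
  have hden (b : B) : ∃ y : ℤ, y ≠ 0 ∧ IsIntegral ℤ (y * f b) := by
    have h : IsAlgebraic ℤ (f b) :=
      (IsFractionRing.isAlgebraic_iff ℤ ℚ L).2 (Algebra.IsAlgebraic.isAlgebraic _)
    obtain ⟨y, hy, h⟩ := h.exists_integral_multiple
    exact ⟨y, hy, by simpa using h⟩
  choose y hy hyint using hden
  have hint (z : ℤ) : IsIntegral ℤ (z : L) := isIntegral_algebraMap (R := ℤ) (x := z)
  let M : ℤ := ∏ b ∈ hT.toFinset, y b
  have hM : M ≠ 0 := Finset.prod_ne_zero_iff.2 fun b _ => hy b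
  have key (b : B) (hb : b ∈ Algebra.adjoin ℤ T) : ∃ D : ℕ, IsIntegral ℤ ((M : L) ^ D * f b) := by
    induction hb using Algebra.adjoin_induction with
    | mem b hb =>
      refine ⟨1, ?_⟩
      obtain ⟨z, hz⟩ : y b ∣ M := Finset.dvd_prod_of_mem _ (hT.mem_toFinset.2 hb)
      convert! (hint z).mul (hyint b) using 1
      rw [hz]
      push_cast
      ring
    | algebraMap r => exact ⟨0, by simpa using hint r⟩
    | add u v _ _ hu hv =>
      obtain ⟨D, hD⟩ := hu
      obtain ⟨D', hD'⟩ := hv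
      refine ⟨D + D', ?_⟩
      convert! (((hint M).pow D').mul hD).add (((hint M).pow D).mul hD') using 1
      rw [map_add]
      ring
    | mul u v _ _ hu hv =>
      obtain ⟨D, hD⟩ := hu
      obtain ⟨D', hD'⟩ := hv
      refine ⟨D + D', ?_⟩
      convert! hD.mul hD' using 1
      rw [map_mul]
      ring
  refine ⟨M.natAbs, fun p hp hMp b hb hpb => ?_⟩
  obtain ⟨D, hD⟩ := key b hb
  have hpf : (p : L) * f b = 1 := by rw [← map_one f, ← hpb, map_mul, map_natCast]
  have hp0 : (p : ℚ) ≠ 0 := by exact_mod_cast hp.ne_zero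
  have hq : algebraMap ℚ L ((M : ℚ) ^ D / p) = (M : L) ^ D * f b := by
    rw [map_div₀, div_eq_iff ((map_ne_zero _).2 hp0)]
    simp only [map_pow, map_intCast, map_natCast]
    rw [mul_assoc, mul_comm (f b), hpf, mul_one]
  rw [← hq, isIntegral_algebraMap_iff (algebraMap ℚ L).injective] at hD
  obtain ⟨z, hz⟩ := IsIntegrallyClosed.isIntegral_iff.1 hD
  rw [eq_div_iff hp0] at hz
  have hz' : M ^ D = p * z := by
    rw [eq_intCast] at hz
    rw [mul_comm]
    exact_mod_cast hz.symm
  have hdvd : (p : ℤ) ∣ M := (Nat.prime_iff_prime_int.1 hp).dvd_of_dvd_pow ⟨z, hz'⟩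
  exact absurd (Nat.le_of_dvd (Int.natAbs_pos.2 hM) (Int.natCast_dvd.1 hdvd)) (by omega)

/-- Only finitely many primes become invertible in a finitely generated subring of `ℂ`. -/
lemma exists_forall_prime_mul_ne_one {S : Set ℂ} (hS : S.Finite) :
    ∃ N : ℕ, ∀ p : ℕ, p.Prime → N < p → ∀ a ∈ Algebra.adjoin ℤ S, (p : ℂ) * a ≠ 1 := by
  let B := Algebra.adjoin ℚ S
  have hB : Algebra.FiniteType ℚ B := .adjoin_of_finite hS
  obtain ⟨I, hI⟩ := Ideal.exists_maximal B
  let _ : Field (B ⧸ I) := Ideal.Quotient.field I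
  have : Algebra.FiniteType ℚ (B ⧸ I) :=
    hB.of_surjective (Ideal.Quotient.mkₐ ℚ I) (Ideal.Quotient.mkₐ_surjective ℚ I)
  have : Module.Finite ℚ (B ⧸ I) := finite_of_finite_type_of_isJacobsonRing ℚ (B ⧸ I)
  obtain ⟨N, hN⟩ := exists_forall_prime_mul_ne_one_of_ringHom (Ideal.Quotient.mk I)
    (hS.preimage (f := ((↑) : B → ℂ)) Subtype.val_injective.injOn)
  refine ⟨N, fun p hp hNp a ha hpa => ?_⟩
  have himage : ((↑) : B → ℂ) '' ((↑) ⁻¹' S) = S :=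
    Set.image_preimage_eq_of_subset fun x hx => ⟨⟨x, Algebra.subset_adjoin hx⟩, rfl⟩
  let ι : B →ₐ[ℤ] ℂ := B.val.restrictScalars ℤ
  have hmem : a ∈ (Algebra.adjoin ℤ (((↑) : B → ℂ) ⁻¹' S)).map ι := by
    rw [AlgHom.map_adjoin]
    exact himage.symm ▸ ha
  obtain ⟨b, hb, rfl⟩ := hmem
  exact hN p hp hNp b hb (Subtype.ext (by simpa [ι] using hpa))

lemma pow_succ_dvd_add_pow_sub_pow {R : Type*} [CommRing R] {x a b : R} {k : ℕ}
    (ha : x ^ k ∣ a) (hb : x ^ (k + 1) ∣ b) (m : ℕ) :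
    x ^ (k * m + 1) ∣ (a + b) ^ m - a ^ m := by
  obtain ⟨h, rfl⟩ := ha
  obtain ⟨g, rfl⟩ := hb
  obtain ⟨q, hq⟩ := sub_dvd_pow_sub_pow (h + x * g) h m
  refine ⟨g * q, ?_⟩
  have : x ^ k * h + x ^ (k + 1) * g = x ^ k * (h + x * g) := by ring
  rw [this, mul_pow, mul_pow, ← mul_sub, hq]
  ring

/-- let `F = c₀ M₀ + ∑ᵢ cᵢ Mᵢ` where `M₀ = x₁^{k₁} ⋯ xₙ^{kₙ}` with
`k₁ ≥ 1` and `k₁ ≥ k_j` for all `j`, `c₀ ≠ 0`, and each `Mᵢ` is a monomial divisible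
by `x₁^{k₁+1}`.  Then `E(F^m) ≠ 0` for infinitely many `m ≥ 1`.  Here the first
variable `x₁` is `X ⟨0, hn⟩`. -/
theorem gaussian_moments_ne_zero_special_form (n d : ℕ) (hn : 0 < n)
    (k : Fin n → ℕ) (hk1 : 1 ≤ k ⟨0, hn⟩) (hkmax : ∀ j : Fin n, k j ≤ k ⟨0, hn⟩)
    (c₀ : ℂ) (hc₀ : c₀ ≠ 0) (c : Fin d → ℂ) (e : Fin d → (Fin n →₀ ℕ))
    (he : ∀ i : Fin d, k ⟨0, hn⟩ + 1 ≤ e i ⟨0, hn⟩) :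
    {m : ℕ | 1 ≤ m ∧
      gaussExp
        ((MvPolynomial.monomial (Finsupp.equivFunOnFinite.symm k) c₀ +
          ∑ i : Fin d, MvPolynomial.monomial (e i) (c i)) ^ m) ≠ 0}.Infinite := by
  set k₁ := k ⟨0, hn⟩ with hk₁
  set κ : Fin n →₀ ℕ := Finsupp.equivFunOnFinite.symm k with hκ
  let S : Set ℂ := {c₀, c₀⁻¹} ∪ Set.range c
  obtain ⟨N, hN⟩ := exists_forall_prime_mul_ne_one (S := S)
    (((Set.finite_singleton _).insert _).union (Set.finite_range c))
  let A := Algebra.adjoin ℤ S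
  let φ : A →+* ℂ := A.val.toRingHom
  let u₀ : A := ⟨c₀, Algebra.subset_adjoin (by simp [S])⟩
  let v₀ : A := ⟨c₀⁻¹, Algebra.subset_adjoin (by simp [S])⟩
  let u : Fin d → A := fun i => ⟨c i, Algebra.subset_adjoin (by simp [S])⟩
  let H : MvPolynomial (Fin n) A := MvPolynomial.monomial κ u₀
  let G : MvPolynomial (Fin n) A := ∑ i, MvPolynomial.monomial (e i) (u i)
  refine Set.infinite_of_forall_exists_gt fun b => ?_
  obtain ⟨p, hp, hpgt, hpmod⟩ :=
    Nat.exists_prime_gt_modEq_one (k := 2 * k₁) (N + k₁ * b + 1) (by omega)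
  obtain ⟨q, hq⟩ := (Nat.modEq_iff_dvd' hp.one_le).1 hpmod.symm
  have hpq : p = k₁ * (2 * q) + 1 := by
    have := hp.one_le
    rw [show k₁ * (2 * q) = 2 * k₁ * q by ring]
    omega
  have hbm : b < 2 * q := Nat.lt_of_mul_lt_mul_left (a := k₁) (by omega)
  refine ⟨2 * q, ⟨by omega, fun h0 => ?_⟩, hbm⟩
  have hpodd : Odd p := ⟨k₁ * q, by rw [hpq]; ring⟩
  have hXH : MvPolynomial.X ⟨0, hn⟩ ^ k₁ ∣ H := by
    rw [MvPolynomial.X_pow_eq_monomial]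
    exact MvPolynomial.monomial_dvd_monomial.2 ⟨.inr (by simp [hκ, hk₁]), one_dvd _⟩
  have hXG : MvPolynomial.X ⟨0, hn⟩ ^ (k₁ + 1) ∣ G := by
    refine Finset.dvd_sum fun i _ => ?_
    rw [MvPolynomial.X_pow_eq_monomial]
    exact MvPolynomial.monomial_dvd_monomial.2 ⟨.inr (Finsupp.single_le_iff.2 (he i)), one_dvd _⟩
  obtain ⟨a, ha⟩ := exists_gaussExp_eq_mul_of_X_pow_dvd φ hpodd _
    (hpq ▸ pow_succ_dvd_add_pow_sub_pow hXH hXG (2 * q))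
  set w : ℕ := ∏ j, gaussMoment (2 * q * k j) with hw
  have hpw : p.Coprime w := by
    refine Nat.Coprime.prod_right fun j _ => (hp.coprime_iff_not_dvd).2 ?_
    refine not_dvd_gaussMoment hp ⟨q * k j, by ring⟩ ?_
    have := Nat.mul_le_mul_left (2 * q) (hkmax j)
    rw [hpq, mul_comm k₁]
    omega
  have hmap : MvPolynomial.map φ ((H + G) ^ (2 * q) - H ^ (2 * q)) +
      MvPolynomial.monomial ((2 * q) • κ) (c₀ ^ (2 * q)) =
      (MvPolynomial.monomial κ c₀ + ∑ i : Fin d, MvPolynomial.monomial (e i) (c i)) ^ (2 * q) := by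
    rw [← MvPolynomial.monomial_pow]
    simp [H, G, φ, u₀, u]
  rw [← hmap, gaussExp_add, ha, gaussExp_monomial, ← Nat.cast_prod] at h0
  have hw' : ∏ j, gaussMoment (((2 * q) • κ) j) = w := by simp [hw, hκ]
  rw [hw'] at h0
  obtain ⟨s, t, hst⟩ := (Nat.isCoprime_iff_coprime.2 hpw)
  refine hN p hp (by omega) _ (s - t * v₀ ^ (2 * q) * a : A).2 ?_
  have hst' : (s : ℂ) * p + t * w = 1 := by exact_mod_cast hst
  have hv : c₀⁻¹ ^ (2 * q) * c₀ ^ (2 * q) = 1 := by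
    rw [← mul_pow, inv_mul_cancel₀ hc₀, one_pow]
  have hcoe : ((s - t * v₀ ^ (2 * q) * a : A) : ℂ) = s - t * c₀⁻¹ ^ (2 * q) * φ a := by
    simp [v₀, φ]
  rw [hcoe]
  linear_combination hst' - t * c₀⁻¹ ^ (2 * q) * h0 + t * w * hv
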